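/- arXiv:1111.5658 — 3 statements merged into one kernel-verified Lean document; each statement's English description precedes it below -/
import Mathlib

section
/- Let p be stable of degree (n,m) and a_k the coefficient polynomials of the kernel L. Then in L²(dσ/|p|²), a_k is orthogonal to the set O_k = {z^i w^j : i>n, j<0} ∪ {z^i w^j : 0≤j<m, j≠k} ∪ {z^i w^j : i<n, j≥m} ∪ {z^i w^k : i≠n}. -/
open Complex MeasureTheory Finset
open scoped ComplexInnerProductSpace

noncomputable section

/-- Evaluation of a bivariate polynomial with coefficient array `c i j`,
supported on `0 ≤ i ≤ n`, `0 ≤ j ≤ m`. -/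
def evalP (n m : ℕ) (c : ℕ → ℕ → ℂ) (z w : ℂ) : ℂ :=
  ∑ i ∈ Finset.range (n + 1), ∑ j ∈ Finset.range (m + 1), c i j * z ^ i * w ^ j

/-- `p` is stable: nonvanishing on the closed bidisk. -/
def Stable (n m : ℕ) (c : ℕ → ℕ → ℂ) : Prop :=
  ∀ z w : ℂ, ‖z‖ ≤ 1 → ‖w‖ ≤ 1 → evalP n m c z w ≠ 0

/-- `p` has degree exactly `n` in `z` and `m` in `w`. -/
def DegreeNM (n m : ℕ) (c : ℕ → ℕ → ℂ) : Prop :=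
  (∃ j, c n j ≠ 0) ∧ (∃ i, c i m ≠ 0)

/-- Coefficients of the reflected polynomial `p̃(z,w) = zⁿ wᵐ conj (p (1/z̄, 1/w̄))`. -/
def reflC (n m : ℕ) (c : ℕ → ℕ → ℂ) : ℕ → ℕ → ℂ :=
  fun i j => star (c (n - i) (m - j))

/-- The Laurent monomial `z^i w^j` as a function on the torus, `z = e^{iθ}`, `w = e^{iφ}`. -/
def tmono (i j : ℤ) : ℝ → ℝ → ℂ :=
  fun θ φ => Complex.exp (((i : ℂ) * (θ : ℂ) + (j : ℂ) * (φ : ℂ)) * Complex.I)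

/-- A bivariate polynomial as a function on the torus. -/
def onT (n m : ℕ) (c : ℕ → ℕ → ℂ) : ℝ → ℝ → ℂ :=
  fun θ φ => evalP n m c (Complex.exp ((θ : ℂ) * Complex.I)) (Complex.exp ((φ : ℂ) * Complex.I))

/-- The inner product `⟨f,g⟩ = ∫_{𝕋²} f ḡ dσ/|p|²` of `L²(dσ/|p|²)`. -/
def ip (n m : ℕ) (c : ℕ → ℕ → ℂ) (f g : ℝ → ℝ → ℂ) : ℂ :=
  (1 / (2 * Real.pi) ^ 2 : ℂ) *
    ∫ θ in (0 : ℝ)..(2 * Real.pi), ∫ φ in (0 : ℝ)..(2 * Real.pi),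
      f θ φ * star (g θ φ) / ((Complex.normSq (onT n m c θ φ) : ℝ) : ℂ)

/-- Numerator of the Christoffel–Darboux-type kernel `L`:
`zⁿ (p(z,w) conj(p(1/z̄,η)) − p̃(z,w) conj(p̃(1/z̄,η)))`. -/
def Lnum (n m : ℕ) (c : ℕ → ℕ → ℂ) (z w η : ℂ) : ℂ :=
  z ^ n * (evalP n m c z w * star (evalP n m c (star z)⁻¹ η)
    - evalP n m (reflC n m c) z w * star (evalP n m (reflC n m c) (star z)⁻¹ η))

/-- The kernel built from coefficient arrays `a k` for the polynomials `a_k(z,w)`: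
`L(z,w;η) = Σ_{k<m} a_k(z,w) η̄^k`. -/
def Lsum (n m : ℕ) (a : ℕ → ℕ → ℕ → ℂ) (z w η : ℂ) : ℂ :=
  ∑ k ∈ Finset.range m, evalP (2 * n) (m - 1) (a k) z w * (star η) ^ k

/-- `a` is the coefficient array of the kernel `L` associated with `p`:
`(1 - w η̄) L(z,w;η) = Lnum(z,w;η)` for all `z ≠ 0`. -/
def IsLCoeff (n m : ℕ) (c : ℕ → ℕ → ℂ) (a : ℕ → ℕ → ℕ → ℂ) : Prop :=
  ∀ z w η : ℂ, z ≠ 0 → (1 - w * star η) * Lsum n m a z w η = Lnum n m c z w η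

end

noncomputable section

/-- the point `e^{iθ}` -/
def EE (θ : ℝ) : ℂ := Complex.exp ((θ : ℂ) * Complex.I)

lemma EE_cont : Continuous EE := by unfold EE; fun_prop

lemma EE_norm (θ : ℝ) : ‖EE θ‖ = 1 := Complex.norm_exp_ofReal_mul_I θ

lemma EE_ne (θ : ℝ) : EE θ ≠ 0 := Complex.exp_ne_zero _

lemma EE_star (θ : ℝ) : star (EE θ) = (EE θ)⁻¹ :=
  (Complex.inv_eq_conj (EE_norm θ)).symm

lemma EE_zpow (θ : ℝ) (s : ℤ) : EE θ ^ s = Complex.exp ((s : ℂ) * (θ : ℂ) * Complex.I) := by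
  rw [EE, ← Complex.exp_int_mul]; ring_nf

lemma EE_zpow_cont (s : ℤ) : Continuous (fun θ => EE θ ^ s) :=
  EE_cont.zpow₀ s (fun θ => Or.inl (EE_ne θ))

/-- double integral over the torus -/
def dint (f : ℝ → ℝ → ℂ) : ℂ :=
  ∫ θ in (0 : ℝ)..(2 * Real.pi), ∫ φ in (0 : ℝ)..(2 * Real.pi), f θ φ

lemma dint_inner_cont {f : ℝ → ℝ → ℂ} (hf : Continuous (Function.uncurry f)) :
    Continuous (fun θ => ∫ φ in (0 : ℝ)..(2 * Real.pi), f θ φ) :=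
  intervalIntegral.continuous_parametric_intervalIntegral_of_continuous' hf _ _

lemma cont_slice {f : ℝ → ℝ → ℂ} (hf : Continuous (Function.uncurry f)) (θ : ℝ) :
    Continuous (f θ) :=
  hf.comp (by fun_prop : Continuous (fun φ : ℝ => (θ, φ)))

lemma dint_sub {f g : ℝ → ℝ → ℂ} (hf : Continuous (Function.uncurry f))
    (hg : Continuous (Function.uncurry g)) :
    dint (fun θ φ => f θ φ - g θ φ) = dint f - dint g := by
  unfold dint
  rw [← intervalIntegral.integral_sub ((dint_inner_cont hf).intervalIntegrable _ _)
    ((dint_inner_cont hg).intervalIntegrable _ _)]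
  congr 1
  ext θ
  rw [intervalIntegral.integral_sub ((cont_slice hf θ).intervalIntegrable _ _)
    ((cont_slice hg θ).intervalIntegrable _ _)]

lemma dint_sum (s : Finset ℕ) {f : ℕ → ℝ → ℝ → ℂ}
    (hf : ∀ l ∈ s, Continuous (Function.uncurry (f l))) :
    dint (fun θ φ => ∑ l ∈ s, f l θ φ) = ∑ l ∈ s, dint (f l) := by
  unfold dint
  rw [← intervalIntegral.integral_finsetSum
    (fun l hl => (dint_inner_cont (hf l hl)).intervalIntegrable _ _)]
  congr 1
  ext θ
  rw [intervalIntegral.integral_finsetSum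
    (fun l hl => (cont_slice (hf l hl) θ).intervalIntegrable _ _)]

lemma dint_swap {f : ℝ → ℝ → ℂ} (hf : Continuous (Function.uncurry f)) :
    dint f = dint (fun φ θ => f θ φ) := by
  unfold dint
  apply MeasureTheory.intervalIntegral_intervalIntegral_swap
  apply (hf.continuousOn.integrableOn_compact (isCompact_uIcc.prod isCompact_uIcc)).mono_set 
  exact Set.prod_mono Set.uIoc_subset_uIcc Set.uIoc_subset_uIcc

lemma dint_star (f : ℝ → ℝ → ℂ) : dint (fun θ φ => star (f θ φ)) = star (dint f) := by
  unfold dint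
  simp only [intervalIntegral.integral_of_le Real.two_pi_pos.le]
  have := fun g : ℝ → ℂ => integral_conj (μ := volume.restrict (Set.Ioc 0 (2 * Real.pi))) (f := g)
  simp only [starRingEnd_apply] at this
  rw [← this]
  congr 1
  ext θ
  rw [← this]

lemma circ_zero (f : ℂ → ℂ) (hf : ∀ z, ‖z‖ ≤ 1 → DifferentiableAt ℂ f z) (h0 : f 0 = 0) :
    ∫ θ in (0 : ℝ)..(2 * Real.pi), f (EE θ) = 0 := by
  have h := circleAverage_of_differentiable_on_off_countable (f := f) (c := 0) (R := 1)
    Set.countable_empty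
    (fun z hz => (hf z (by simpa using hz)).continuousAt.continuousWithinAt)
    (fun z hz => hf z (by simpa using (show ‖z‖ < 1 by simpa using hz).le))
  rw [h0, Real.circleAverage_def] at h
  simpa [circleMap, EE, Real.pi_ne_zero] using h

/-- holomorphic functions on the closed bidisk -/
structure Hol (G : ℂ → ℂ → ℂ) : Prop where
  d1 : ∀ z w, ‖z‖ ≤ 1 → ‖w‖ ≤ 1 → DifferentiableAt ℂ (fun z => G z w) z
  d2 : ∀ z w, ‖z‖ ≤ 1 → ‖w‖ ≤ 1 → DifferentiableAt ℂ (fun w => G z w) w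
  cont : Continuous (Function.uncurry (fun θ φ : ℝ => G (EE θ) (EE φ)))

lemma Hol.cont_mul {G : ℂ → ℂ → ℂ} (h : Hol G) (s t : ℤ) :
    Continuous (Function.uncurry (fun θ φ : ℝ => EE θ ^ s * EE φ ^ t * G (EE θ) (EE φ))) :=
  (((EE_zpow_cont s).comp continuous_fst).mul ((EE_zpow_cont t).comp continuous_snd)).mul h.cont

lemma Hol.cont_mul_star {G : ℂ → ℂ → ℂ} (h : Hol G) (s t : ℤ) :
    Continuous (Function.uncurry
      (fun θ φ : ℝ => EE θ ^ s * EE φ ^ t * star (G (EE θ) (EE φ)))) :=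
  (((EE_zpow_cont s).comp continuous_fst).mul ((EE_zpow_cont t).comp continuous_snd)).mul
    h.cont.star

lemma circ_zero_zpow (f : ℂ → ℂ) (hf : ∀ z, ‖z‖ ≤ 1 → DifferentiableAt ℂ f z) (t : ℤ)
    (ht : 0 < t) : ∫ θ in (0 : ℝ)..(2 * Real.pi), EE θ ^ t * f (EE θ) = 0 := by
  lift t to ℕ using ht.le
  simp only [zpow_natCast]
  exact circ_zero (fun z => z ^ t * f z) (fun z hz => (differentiableAt_pow t).mul (hf z hz))
    (by simp [zero_pow (by omega : t ≠ 0)])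

lemma Hol.w_zero {G : ℂ → ℂ → ℂ} (h : Hol G) (s t : ℤ) (ht : 0 < t) :
    dint (fun θ φ => EE θ ^ s * EE φ ^ t * G (EE θ) (EE φ)) = 0 := by
  unfold dint
  simp only [mul_assoc, intervalIntegral.integral_const_mul]
  have : ∀ θ, ∫ φ in (0 : ℝ)..(2 * Real.pi), EE φ ^ t * G (EE θ) (EE φ) = 0 := fun θ =>
    circ_zero_zpow _ (fun w hw => h.d2 _ w (EE_norm θ).le hw) t ht
  simp [this]

lemma Hol.symm {G : ℂ → ℂ → ℂ} (h : Hol G) : Hol (fun z w => G w z) :=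
  ⟨fun z w hz hw => h.d2 w z hw hz, fun z w hz hw => h.d1 w z hw hz,
    h.cont.comp continuous_swap⟩

lemma Hol.zero {G : ℂ → ℂ → ℂ} (h : Hol G) (s t : ℤ) (hst : 0 < s ∨ 0 < t) :
    dint (fun θ φ => EE θ ^ s * EE φ ^ t * G (EE θ) (EE φ)) = 0 := by
  rcases hst with hs | ht
  · rw [dint_swap (h.cont_mul s t), ← h.symm.w_zero t s hs]
    congr 1
    ext θ φ
    ring
  · exact h.w_zero s t ht

lemma Hol.zero_star {G : ℂ → ℂ → ℂ} (h : Hol G) (s t : ℤ) (hst : s < 0 ∨ t < 0) :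
    dint (fun θ φ => EE θ ^ s * EE φ ^ t * star (G (EE θ) (EE φ))) = 0 := by
  have := h.zero (-s) (-t) (by omega)
  rw [← star_eq_zero, ← dint_star] at this
  rw [← this]
  congr 1
  ext θ φ
  have e : ∀ (x : ℝ) (r : ℤ), star (EE x ^ (-r)) = EE x ^ r := by
    intro x r
    have : star (EE x ^ (-r)) = (star (EE x)) ^ (-r) := map_zpow₀ (starRingEnd ℂ) _ _
    rw [this, EE_star, inv_zpow', neg_neg]
  rw [star_mul', star_mul', e, e]

lemma hol_one : Hol (fun _ _ => 1) :=
  ⟨fun _ _ _ _ => by fun_prop, fun _ _ _ _ => by fun_prop, by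
    simp only [Function.uncurry_def]; fun_prop⟩

lemma dint_mono (s t : ℤ) (hst : s ≠ 0 ∨ t ≠ 0) :
    dint (fun θ φ => EE θ ^ s * EE φ ^ t) = 0 := by
  by_cases h : 0 < s ∨ 0 < t
  · simpa using hol_one.zero s t h
  · simpa using hol_one.zero_star s t (by omega)

/-- the coefficient of `w^l` as a polynomial in `z` -/
def pc (n : ℕ) (c : ℕ → ℕ → ℂ) (l : ℕ) (z : ℂ) : ℂ :=
  ∑ i ∈ Finset.range (n + 1), c i l * z ^ i

lemma evalP_eq (n m : ℕ) (c : ℕ → ℕ → ℂ) (z w : ℂ) :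
    evalP n m c z w = ∑ l ∈ Finset.range (m + 1), pc n c l z * w ^ l := by
  unfold evalP pc
  rw [Finset.sum_comm]
  simp only [Finset.sum_mul]

lemma pc_refl (n m : ℕ) (c : ℕ → ℕ → ℂ) (l : ℕ) (z : ℂ) (hz : ‖z‖ = 1) :
    pc n (reflC n m c) l z = z ^ n * star (pc n c (m - l) z) := by
  have hz0 : z ≠ 0 := by rintro rfl; simp at hz
  have hs : star z = z⁻¹ := (Complex.inv_eq_conj hz).symm
  unfold pc reflC
  rw [← Finset.sum_range_reflect, star_sum, Finset.mul_sum]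
  apply Finset.sum_congr rfl
  intro i hi
  have hi : i ≤ n := by simpa [Nat.lt_succ_iff] using hi
  have e1 : n + 1 - 1 - i = n - i := by omega
  have e2 : n - (n - i) = i := by omega
  rw [e1, e2, star_mul', star_pow, hs, pow_sub₀ _ hz0 hi, inv_pow]
  ring

lemma evalP_refl (n m : ℕ) (c : ℕ → ℕ → ℂ) (z w : ℂ) (hz : ‖z‖ = 1) (hw : ‖w‖ = 1) :
    evalP n m (reflC n m c) z w = z ^ n * w ^ m * star (evalP n m c z w) := by
  have hw0 : w ≠ 0 := by rintro rfl; simp at hw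
  have hs : star w = w⁻¹ := (Complex.inv_eq_conj hw).symm
  rw [evalP_eq, evalP_eq, ← Finset.sum_range_reflect, star_sum, Finset.mul_sum]
  apply Finset.sum_congr rfl
  intro i hi
  have hi : i ≤ m := by simpa [Nat.lt_succ_iff] using hi
  have e1 : m + 1 - 1 - i = m - i := by omega
  have e2 : m - (m - i) = i := by omega
  rw [pc_refl n m c _ z hz, e1, e2, star_mul', star_pow, hs, pow_sub₀ _ hw0 hi, inv_pow]
  ring

lemma coeff_lemma (m : ℕ) (A B : ℕ → ℂ) (w : ℂ)
    (h : ∀ x : ℂ, (1 - w * x) * ∑ k ∈ Finset.range m, A k * x ^ k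
      = ∑ l ∈ Finset.range (m + 1), B l * x ^ l) (k : ℕ) (hk : k < m) :
    A k = ∑ l ∈ Finset.range (k + 1), w ^ (k - l) * B l := by
  have hp : (1 - Polynomial.C w * Polynomial.X) *
      (∑ k ∈ Finset.range m, Polynomial.C (A k) * Polynomial.X ^ k)
      = ∑ l ∈ Finset.range (m + 1), Polynomial.C (B l) * Polynomial.X ^ l := by
    apply Polynomial.funext
    intro x
    simpa [Polynomial.eval_finsetSum] using h x
  have hc : ∀ k < m, A k = w * (if k = 0 then 0 else A (k - 1)) + B k := by
    intro k hk
    have := congrArg (fun q => Polynomial.coeff q k) hp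
    rcases k with _ | k
    · simp [sub_mul, mul_assoc, Polynomial.coeff_C_mul, Polynomial.coeff_X_pow,
        Polynomial.finsetSum_coeff, hk] at this
      simpa using this
    · have hk' : k < m := by omega
      have hk'' : k < m := by omega
      simp [sub_mul, mul_assoc, Polynomial.coeff_C_mul, Polynomial.coeff_X_pow,
        Polynomial.finsetSum_coeff, hk, Polynomial.coeff_X_mul, hk', hk'.le] at this
      simp only [Nat.add_sub_cancel, Nat.succ_ne_zero, if_false]
      linear_combination this
  induction k with
  | zero => simpa using hc 0 hk
  | succ k ih =>
    rw [hc _ hk, Finset.sum_range_succ]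
    simp only [Nat.add_sub_cancel, Nat.succ_ne_zero, if_false]
    rw [ih (by omega), Finset.mul_sum]
    congr 1
    · apply Finset.sum_congr rfl
      intro l hl
      have : k + 1 - l = (k - l) + 1 := by simp at hl; omega
      rw [this, pow_succ]; ring
    · simp

lemma a_formula (n m : ℕ) (c : ℕ → ℕ → ℂ) (a : ℕ → ℕ → ℕ → ℂ) (ha : IsLCoeff n m c a)
    (k : ℕ) (hk : k < m) (z w : ℂ) (hz : ‖z‖ = 1) (hw : ‖w‖ = 1) :
    evalP (2 * n) (m - 1) (a k) z w = ∑ l ∈ Finset.range (k + 1), w ^ (k - l) *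
      (z ^ n * (evalP n m c z w * star (pc n c l z)
        - w ^ m * star (evalP n m c z w) * pc n c (m - l) z)) := by
  have hz0 : z ≠ 0 := by rintro rfl; simp at hz
  have hs : star z = z⁻¹ := (Complex.inv_eq_conj hz).symm
  refine coeff_lemma m (fun k => evalP (2 * n) (m - 1) (a k) z w) _ w ?_ k hk
  intro x
  have h := ha z w (star x) hz0
  unfold Lsum Lnum at h
  simp only [star_star, hs, inv_inv] at h
  rw [h, evalP_refl n m c z w hz hw, evalP_eq n m c z (star x),
    evalP_eq n m (reflC n m c) z (star x)]
  simp only [star_sum, Finset.mul_sum, ← Finset.sum_sub_distrib]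
  apply Finset.sum_congr rfl
  intro l hl
  simp only [pc_refl n m c _ z hz, star_mul', star_pow, hs, star_star]
  have : z ^ n * z⁻¹ ^ n = 1 := by rw [← mul_pow, mul_inv_cancel₀ hz0, one_pow]
  linear_combination (-z ^ n * w ^ m * star (evalP n m c z w) * pc n c (m - l) z * x ^ l) * this

lemma hol_div (n m : ℕ) (c : ℕ → ℕ → ℂ) (hst : Stable n m c) (l : ℕ) :
    Hol (fun z w => pc n c l z / evalP n m c z w) where
  d1 z w hz hw := by
    apply DifferentiableAt.fun_div (d := fun z => evalP n m c z w) _ _ (hst z w hz hw)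
    · unfold pc; fun_prop
    · unfold evalP; fun_prop
  d2 z w hz hw := by
    apply DifferentiableAt.div _ _ (hst z w hz hw)
    · fun_prop
    · unfold evalP; fun_prop
  cont := by
    have := EE_cont
    simp only [Function.uncurry_def]
    apply Continuous.div
    · unfold pc; fun_prop
    · unfold evalP; fun_prop
    · intro x
      exact hst _ _ (EE_norm _).le (EE_norm _).le

lemma integrand_eq (n m : ℕ) (c : ℕ → ℕ → ℂ) (hst : Stable n m c)
    (a : ℕ → ℕ → ℕ → ℂ) (ha : IsLCoeff n m c a)
    (k : ℕ) (hk : k < m) (i j : ℤ) (θ φ : ℝ) :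
    tmono i j θ φ * star (onT (2 * n) (m - 1) (a k) θ φ) /
      ((Complex.normSq (onT n m c θ φ) : ℝ) : ℂ)
    = (∑ l ∈ Finset.range (k + 1), EE θ ^ (i - n) * EE φ ^ (j - k + l) *
        (pc n c l (EE θ) / evalP n m c (EE θ) (EE φ)))
      - ∑ l ∈ Finset.range (k + 1), EE θ ^ (i - n) * EE φ ^ (j - k + l - m) *
        star (pc n c (m - l) (EE θ) / evalP n m c (EE θ) (EE φ)) := by
  have h1 : tmono i j θ φ = EE θ ^ i * EE φ ^ j := by
    rw [EE_zpow, EE_zpow, ← Complex.exp_add, tmono]; ring_nf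
  have h2 : ∀ N M d, onT N M d θ φ = evalP N M d (EE θ) (EE φ) := fun _ _ _ => rfl
  rw [h1, h2, h2, a_formula n m c a ha k hk _ _ (EE_norm θ) (EE_norm φ),
    ← Finset.sum_sub_distrib, star_sum, Finset.mul_sum, Finset.sum_div]
  apply Finset.sum_congr rfl
  intro l hl
  have hl : l ≤ k := by simpa [Nat.lt_succ_iff] using hl
  have hp := hst _ _ (EE_norm θ).le (EE_norm φ).le
  set p := evalP n m c (EE θ) (EE φ)
  have hps : star p ≠ 0 := star_ne_zero.mpr hp
  have hn : ((Complex.normSq p : ℝ) : ℂ) = p * star p := (Complex.mul_conj p).symm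
  have hz := EE_ne θ
  have hw := EE_ne φ
  have e1 : EE φ ^ (j - k + l) = EE φ ^ j * (EE φ ^ (k - l))⁻¹ := by
    rw [← zpow_natCast, ← zpow_neg, ← zpow_add₀ hw]; congr 1; push_cast [hl]; ring
  rw [hn, zpow_sub₀ hz, zpow_sub₀ hw, e1]
  simp only [star_mul', star_sub, star_pow, star_star, EE_star, star_div₀, zpow_natCast, inv_pow]
  field_simp

theorem statement8_aux (n m : ℕ) (c : ℕ → ℕ → ℂ)
    (hstable : Stable n m c)
    (a : ℕ → ℕ → ℕ → ℂ) (ha : IsLCoeff n m c a)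
    (k : ℕ) (hk : k < m) (i j : ℤ)
    (hij : ((n : ℤ) < i ∧ j < 0)
      ∨ (0 ≤ j ∧ j < (m : ℤ) ∧ j ≠ (k : ℤ))
      ∨ (i < (n : ℤ) ∧ (m : ℤ) ≤ j)
      ∨ (j = (k : ℤ) ∧ i ≠ (n : ℤ))) :
    ip n m c (tmono i j) (onT (2 * n) (m - 1) (a k)) = 0 := by
  have H := hol_div n m c hstable
  unfold ip
  simp only [integrand_eq n m c hstable a ha k hk i j]
  change _ * dint (fun θ φ => (∑ l ∈ Finset.range (k + 1), _) - _) = 0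
  have c1 : ∀ l, _ := fun l : ℕ => (H l).cont_mul (i - n) (j - k + l)
  have c2 : ∀ l, _ := fun l : ℕ => (H (m - l)).cont_mul_star (i - n) (j - k + l - m)
  rw [dint_sub, dint_sum _ (fun l _ => c1 l), dint_sum _ (fun l _ => c2 l)]
  rotate_left
  · simp only [Function.uncurry_def]
    exact continuous_finsetSum _ (fun l _ => c1 l)
  · simp only [Function.uncurry_def]
    exact continuous_finsetSum _ (fun l _ => c2 l)
  rw [Finset.sum_eq_zero (f := fun l : ℕ => dint (fun θ φ => EE θ ^ (i - n) *
    EE φ ^ (j - k + l - m) * star (pc n c (m - l) (EE θ) / evalP n m c (EE θ) (EE φ))))]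
  rotate_left
  · intro l hl
    apply (H (m - l)).zero_star
    simp at hl
    omega
  suffices h : ∑ l ∈ Finset.range (k + 1), dint (fun θ φ => EE θ ^ (i - n) *
      EE φ ^ (j - k + l) * (pc n c l (EE θ) / evalP n m c (EE θ) (EE φ))) = 0 by
    rw [h]; simp
  by_cases hj : 0 ≤ j ∧ j < m
  · have hsub : Finset.range (k + 1) ⊆ Finset.range (m + 1) := by
      intro x hx; simp at hx ⊢; omega
    rw [Finset.sum_subset hsub]
    rotate_left
    · intro l hl hl'
      apply (H l).zero
      simp at hl'
      omega
    rw [← dint_sum _ (fun l _ => c1 l), ← dint_mono (i - n) (j - k) (by omega)]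
    congr 1
    ext θ φ
    have hp := hstable _ _ (EE_norm θ).le (EE_norm φ).le
    have hw := EE_ne φ
    calc _ = EE θ ^ (i - n) * EE φ ^ (j - k) * ((∑ l ∈ Finset.range (m + 1),
          pc n c l (EE θ) * EE φ ^ l) / evalP n m c (EE θ) (EE φ)) := by
          rw [Finset.sum_div, Finset.mul_sum]
          apply Finset.sum_congr rfl
          intro l _
          rw [zpow_add₀ hw, zpow_natCast]
          ring
      _ = _ := by rw [← evalP_eq, div_self hp, mul_one]
  · apply Finset.sum_eq_zero
    intro l hl
    apply (H l).zero
    simp at hl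
    omega

end

/-- each a_k is orthogonal to
O_k = {z^i w^j : i>n, j<0} ∪ {z^i w^j : 0≤j<m, j≠k} ∪ {z^i w^j : i<n, j≥m} ∪ {z^i w^k : i≠n}. -/
theorem statement8 (n m : ℕ) (c : ℕ → ℕ → ℂ)
    (hstable : Stable n m c) (hdeg : DegreeNM n m c)
    (a : ℕ → ℕ → ℕ → ℂ) (ha : IsLCoeff n m c a)
    (k : ℕ) (hk : k < m) (i j : ℤ)
    (hij : ((n : ℤ) < i ∧ j < 0)
      ∨ (0 ≤ j ∧ j < (m : ℤ) ∧ j ≠ (k : ℤ))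
      ∨ (i < (n : ℤ) ∧ (m : ℤ) ≤ j)
      ∨ (j = (k : ℤ) ∧ i ≠ (n : ℤ))) :
    ip n m c (tmono i j) (onT (2 * n) (m - 1) (a k)) = 0 := by
  exact statement8_aux n m c hstable a ha k hk i j hij
end

section
/- Let p be stable of degree (n,m). For every fixed η ∈ ℂ, the polynomial L(·,·;η) is orthogonal in L²(dσ/|p|²) to the set O = {z^i w^j : i>n, j<0} ∪ {z^i w^j : i≠n, 0≤j<m} ∪ {z^i w^j : i<n, j≥m}. -/
open Complex MeasureTheory Finset
open scoped ComplexInnerProductSpace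

namespace St9

/-- point on the unit circle -/
noncomputable def e (θ : ℝ) : ℂ := Complex.exp ((θ : ℂ) * Complex.I)

lemma e_ne (θ : ℝ) : e θ ≠ 0 := Complex.exp_ne_zero _

lemma e_norm (θ : ℝ) : ‖e θ‖ = 1 := Complex.norm_exp_ofReal_mul_I θ

lemma e_star (θ : ℝ) : star (e θ) = (e θ)⁻¹ :=
  (Complex.inv_eq_conj (e_norm θ)).symm

lemma e_cont : Continuous e := by unfold e; fun_prop

lemma tmono_eq (i j : ℤ) (θ φ : ℝ) : tmono i j θ φ = e θ ^ i * e φ ^ j := by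
  unfold tmono e
  rw [← Complex.exp_int_mul, ← Complex.exp_int_mul, ← Complex.exp_add]
  congr 1; ring

lemma circ (θ : ℝ) : circleMap 0 1 θ = e θ := by simp [circleMap, e]

lemma evalP_cont (n m : ℕ) (c : ℕ → ℕ → ℂ) :
    Continuous (fun x : ℂ × ℂ => evalP n m c x.1 x.2) := by
  unfold evalP; fun_prop

lemma evalP_comp (n m : ℕ) (c : ℕ → ℕ → ℂ) {f g : ℝ × ℝ → ℂ} (hf : Continuous f)
    (hg : Continuous g) : Continuous (fun x => evalP n m c (f x) (g x)) := by
  unfold evalP; fun_prop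

lemma evalP_diff1 (n m : ℕ) (c : ℕ → ℕ → ℂ) (w : ℂ) :
    Differentiable ℂ (fun z => evalP n m c z w) := by
  unfold evalP; fun_prop

lemma evalP_diff2 (n m : ℕ) (c : ℕ → ℕ → ℂ) (z : ℂ) :
    Differentiable ℂ (fun w => evalP n m c z w) := by
  unfold evalP; fun_prop

/-- Cauchy's formula on the unit circle -/
lemma cauchy (f : ℂ → ℂ) (hf : DifferentiableOn ℂ f (Metric.closedBall 0 1)) (η : ℂ)
    (hη : ‖η‖ < 1) :
    ∫ φ in (0 : ℝ)..(2 * Real.pi), (e φ / (e φ - η)) * f (e φ) = 2 * Real.pi * f η := by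
  have hf' : DiffContOnCl ℂ f (Metric.ball 0 |1|) := by
    apply DifferentiableOn.diffContOnCl
    rw [abs_one, closure_ball _ one_ne_zero]; exact hf
  have h := hf'.circleAverage_smul_div (w := η) (by simpa using hη)
  rw [Real.circleAverage_def] at h
  simp only [circ, sub_zero, smul_eq_mul] at h
  rw [← h, Complex.real_smul]
  push_cast
  have : (Real.pi : ℂ) ≠ 0 := by exact_mod_cast Real.pi_ne_zero
  field_simp

lemma vanish (f : ℂ → ℂ) (hf : DifferentiableOn ℂ f (Metric.closedBall 0 1)) (k : ℤ)
    (hk : 0 < k) :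
    ∫ φ in (0 : ℝ)..(2 * Real.pi), e φ ^ k * f (e φ) = 0 := by
  lift k to ℕ using hk.le
  have hk' : k ≠ 0 := by rintro rfl; simp at hk
  have h := cauchy (fun z => z ^ k * f z)
    ((differentiable_pow k).differentiableOn.mul hf) 0 (by simp)
  simp only [sub_zero, div_self (e_ne _), one_mul, zero_pow hk', zero_mul, mul_zero] at h
  simpa using h

lemma int_star (f : ℝ → ℂ) (a b : ℝ) : ∫ x in a..b, star (f x) = star (∫ x in a..b, f x) := by
  simp only [intervalIntegral, star_sub]
  congr 1 <;> exact integral_conj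

lemma zpow_int (k : ℤ) (hk : k ≠ 0) : ∫ φ in (0 : ℝ)..(2 * Real.pi), e φ ^ k = 0 := by
  have key : ∀ k : ℤ, 0 < k → ∫ φ in (0 : ℝ)..(2 * Real.pi), e φ ^ k = 0 := by
    intro k hk
    simpa using vanish (fun _ => 1) (by fun_prop) k hk
  rcases lt_or_gt_of_ne hk with h | h
  · have h2 := key (-k) (by omega)
    have : ∀ φ, e φ ^ k = star (e φ ^ (-k)) := by
      intro φ; rw [star_zpow₀, e_star]; simp
    simp only [this]
    rw [int_star, h2, star_zero]
  · exact key k h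

lemma swap (F : ℝ → ℝ → ℂ) (hF : Continuous (Function.uncurry F)) (a b c d : ℝ) :
    ∫ x in a..b, ∫ y in c..d, F x y = ∫ y in c..d, ∫ x in a..b, F x y := by
  apply MeasureTheory.intervalIntegral_intervalIntegral_swap
  exact (hF.continuousOn.integrableOn_compact (isCompact_uIcc.prod isCompact_uIcc)).mono_set
    (Set.prod_mono Set.uIoc_subset_uIcc Set.uIoc_subset_uIcc)

lemma refl_star (n m : ℕ) (c : ℕ → ℕ → ℂ) (z s : ℂ) (hz : z ≠ 0) (hz1 : star z = z⁻¹) :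
    star (evalP n m (reflC n m c) z s) =
      (z ^ n)⁻¹ * evalP n m (fun i j => c i (m - j)) z (star s) := by
  unfold evalP reflC
  rw [star_sum, ← Finset.sum_range_reflect, Finset.mul_sum]
  apply Finset.sum_congr rfl
  intro i hi
  rw [star_sum, Finset.mul_sum]
  apply Finset.sum_congr rfl
  intro j hj
  have hi' : i ≤ n := by simpa [Nat.lt_succ_iff] using hi
  have h1 : n + 1 - 1 - i = n - i := by omega
  have h2 : n - (n - i) = i := by omega
  rw [h1, h2]
  simp only [star_mul', star_pow, star_star, hz1, inv_pow]
  have : z ^ n = z ^ i * z ^ (n - i) := by rw [← pow_add]; congr 1; omega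
  rw [this]
  field_simp

lemma rev (n m : ℕ) (c : ℕ → ℕ → ℂ) (z w : ℂ) (hw : w ≠ 0) :
    evalP n m (fun i j => c i (m - j)) z w⁻¹ = (w ^ m)⁻¹ * evalP n m c z w := by
  unfold evalP
  rw [Finset.mul_sum]
  apply Finset.sum_congr rfl
  intro i hi
  rw [← Finset.sum_range_reflect, Finset.mul_sum]
  apply Finset.sum_congr rfl
  intro j hj
  have hj' : j ≤ m := by simpa [Nat.lt_succ_iff] using hj
  have h1 : m + 1 - 1 - j = m - j := by omega
  have h2 : m - (m - j) = j := by omega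
  simp only [h1, h2, inv_pow]
  have : w ^ m = w ^ j * w ^ (m - j) := by rw [← pow_add]; congr 1; omega
  rw [this]
  field_simp

/-- first part of the integrand -/
noncomputable def A (n m : ℕ) (c : ℕ → ℕ → ℂ) (η : ℂ) (i j : ℤ) (θ φ : ℝ) : ℂ :=
  e θ ^ (i - n) * (e φ ^ j * (evalP n m c (e θ) η /
    (evalP n m c (e θ) (e φ) * (1 - (e φ)⁻¹ * η))))

/-- conjugate of the second part of the integrand -/
noncomputable def B (n m : ℕ) (c : ℕ → ℕ → ℂ) (η : ℂ) (i j : ℤ) (θ φ : ℝ) : ℂ :=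
  e θ ^ (n - i) * (e φ ^ (m - j) * (evalP n m (fun i j => c i (m - j)) (e θ) (star η) /
    (evalP n m c (e θ) (e φ) * (1 - e φ * star η))))

lemma one_sub_ne {a b : ℂ} (ha : ‖a‖ ≤ 1) (hb : ‖b‖ < 1) : 1 - a * b ≠ 0 := by
  intro h
  have h1 : a * b = 1 := (sub_eq_zero.mp h).symm
  have h2 : ‖a‖ * ‖b‖ = 1 := by rw [← norm_mul, h1, norm_one]
  nlinarith [norm_nonneg a, norm_nonneg b]

lemma integrand (n m : ℕ) (c : ℕ → ℕ → ℂ) (hs : Stable n m c)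
    (a : ℕ → ℕ → ℕ → ℂ) (ha : IsLCoeff n m c a) (η : ℂ) (hη : ‖η‖ < 1) (i j : ℤ) (θ φ : ℝ) :
    tmono i j θ φ * star (Lsum n m a (e θ) (e φ) η) /
      ((Complex.normSq (onT n m c θ φ) : ℝ) : ℂ) = A n m c η i j θ φ - star (B n m c η i j θ φ) := by
  have hz := e_ne θ
  have hw := e_ne φ
  have hP : evalP n m c (e θ) (e φ) ≠ 0 := hs _ _ (e_norm θ).le (e_norm φ).le
  have hd : 1 - (e φ)⁻¹ * η ≠ 0 := one_sub_ne (by simp [e_norm]) hη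
  have hL : star (Lsum n m a (e θ) (e φ) η) =
      star (Lnum n m c (e θ) (e φ) η) / (1 - (e φ)⁻¹ * η) := by
    rw [eq_div_iff hd, ← ha _ _ _ hz, star_mul', star_sub, star_mul', e_star]
    simp [mul_comm]
  have hN : ((Complex.normSq (onT n m c θ φ) : ℝ) : ℂ) =
      evalP n m c (e θ) (e φ) * star (evalP n m c (e θ) (e φ)) :=
    (Complex.mul_conj _).symm
  have hR1 : star (evalP n m (reflC n m c) (e θ) (e φ)) =
      (e θ ^ n)⁻¹ * ((e φ ^ m)⁻¹ * evalP n m c (e θ) (e φ)) := by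
    rw [refl_star n m c _ _ hz (e_star θ), e_star, rev n m c _ _ hw]
  have hR2 : evalP n m (reflC n m c) (e θ) η =
      e θ ^ n * star (evalP n m (fun i j => c i (m - j)) (e θ) (star η)) := by
    rw [← star_star (evalP n m (reflC n m c) (e θ) η), refl_star n m c _ _ hz (e_star θ)]
    simp only [star_mul', star_inv₀, star_pow, e_star, inv_pow, inv_inv]
  rw [tmono_eq, hL, hN]
  unfold Lnum A B
  have hinv : (star (e θ))⁻¹ = e θ := by rw [e_star, inv_inv]
  rw [hinv]
  simp only [star_mul', star_sub, star_star, star_div₀, star_pow, star_zpow₀, star_one]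
  rw [hR1, hR2]
  simp only [e_star]
  have hP' : star (evalP n m c (e θ) (e φ)) ≠ 0 := star_ne_zero.mpr hP
  generalize star (evalP n m (fun i j => c i (m - j)) (e θ) (star η)) = Q
  generalize star (evalP n m c (e θ) (e φ)) = SP at *
  generalize evalP n m c (e θ) (e φ) = P at *
  generalize evalP n m c (e θ) η = R at *
  generalize 1 - (e φ)⁻¹ * η = D at *
  rw [inv_zpow', inv_zpow', neg_sub, neg_sub, zpow_sub₀ hz, zpow_sub₀ hw, zpow_natCast,
    zpow_natCast, inv_pow]
  field_simp

lemma A_cont (n m : ℕ) (c : ℕ → ℕ → ℂ) (hs : Stable n m c) (η : ℂ) (hη : ‖η‖ < 1) (i j : ℤ) :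
    Continuous (Function.uncurry (A n m c η i j)) := by
  have h1 : Continuous fun x : ℝ × ℝ => e x.1 := e_cont.comp continuous_fst
  have h2 : Continuous fun x : ℝ × ℝ => e x.2 := e_cont.comp continuous_snd
  unfold A Function.uncurry
  refine (h1.zpow₀ _ fun x => Or.inl (e_ne _)).mul ((h2.zpow₀ _ fun x => Or.inl (e_ne _)).mul ?_)
  refine Continuous.div (evalP_comp n m c h1 continuous_const)
    ((evalP_comp n m c h1 h2).mul
      (continuous_const.sub ((h2.inv₀ fun x => e_ne _).mul continuous_const))) ?_
  intro x
  exact mul_ne_zero (hs _ _ (e_norm _).le (e_norm _).le) (one_sub_ne (by simp [e_norm]) hη)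

lemma B_cont (n m : ℕ) (c : ℕ → ℕ → ℂ) (hs : Stable n m c) (η : ℂ) (hη : ‖η‖ < 1) (i j : ℤ) :
    Continuous (Function.uncurry (B n m c η i j)) := by
  have h1 : Continuous fun x : ℝ × ℝ => e x.1 := e_cont.comp continuous_fst
  have h2 : Continuous fun x : ℝ × ℝ => e x.2 := e_cont.comp continuous_snd
  unfold B Function.uncurry
  refine (h1.zpow₀ _ fun x => Or.inl (e_ne _)).mul ((h2.zpow₀ _ fun x => Or.inl (e_ne _)).mul ?_)
  refine Continuous.div (evalP_comp n m _ h1 continuous_const)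
    ((evalP_comp n m c h1 h2).mul
      (continuous_const.sub (h2.mul continuous_const))) ?_
  intro x
  exact mul_ne_zero (hs _ _ (e_norm _).le (e_norm _).le)
    (one_sub_ne (by simp [e_norm]) (by simpa using hη))

lemma A_int (n m : ℕ) (c : ℕ → ℕ → ℂ) (hs : Stable n m c) (η : ℂ) (hη : ‖η‖ < 1) (i j : ℤ)
    (h : (n : ℤ) < i ∨ (i ≠ n ∧ 0 ≤ j)) :
    ∫ θ in (0 : ℝ)..(2 * Real.pi), ∫ φ in (0 : ℝ)..(2 * Real.pi), A n m c η i j θ φ = 0 := by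
  rcases h with h | ⟨h, hj⟩
  · rw [swap _ (A_cont n m c hs η hη i j)]
    have : ∀ φ, ∫ θ in (0 : ℝ)..(2 * Real.pi), A n m c η i j θ φ = 0 := by
      intro φ
      refine vanish (fun z => e φ ^ j * (evalP n m c z η /
        (evalP n m c z (e φ) * (1 - (e φ)⁻¹ * η)))) ?_ (i - n) (by omega)
      refine DifferentiableOn.const_mul (DifferentiableOn.div
        (evalP_diff1 n m c η).differentiableOn
        ((evalP_diff1 n m c (e φ)).differentiableOn.mul_const _) ?_) _
      intro z hz
      exact mul_ne_zero (hs _ _ (by simpa using hz) (e_norm _).le)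
        (one_sub_ne (by simp [e_norm]) hη)
    simp [this]
  · lift j to ℕ using hj
    have : ∀ θ, ∫ φ in (0 : ℝ)..(2 * Real.pi), A n m c η i j θ φ =
        e θ ^ (i - n) * (2 * Real.pi * η ^ j) := by
      intro θ
      have hc := cauchy (fun w => w ^ j * (evalP n m c (e θ) η / evalP n m c (e θ) w)) (by
        refine (differentiable_pow j).differentiableOn.mul (DifferentiableOn.div
          (differentiableOn_const _) (evalP_diff2 n m c (e θ)).differentiableOn ?_)
        intro w hw
        exact hs _ _ (e_norm _).le (by simpa using hw)) η hη
      rw [div_self (hs _ _ (e_norm θ).le hη.le), mul_one] at hc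
      unfold A
      rw [intervalIntegral.integral_const_mul, ← hc]
      congr 2
      ext φ
      have hw := e_ne φ
      have hd : 1 - (e φ)⁻¹ * η = (e φ - η) / e φ := by field_simp
      have hd0 : 1 - (e φ)⁻¹ * η ≠ 0 := one_sub_ne (by simp [e_norm]) hη
      have hd1 : e φ - η ≠ 0 := by
        intro h0; rw [hd, h0] at hd0; simp at hd0
      have hP : evalP n m c (e θ) (e φ) ≠ 0 := hs _ _ (e_norm θ).le (e_norm φ).le
      rw [hd, zpow_natCast]
      field_simp
    simp only [this]
    rw [intervalIntegral.integral_mul_const, zpow_int _ (by omega), zero_mul]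

lemma B_int (n m : ℕ) (c : ℕ → ℕ → ℂ) (hs : Stable n m c) (η : ℂ) (hη : ‖η‖ < 1) (i j : ℤ)
    (h : i < (n : ℤ) ∨ j < m) :
    ∫ θ in (0 : ℝ)..(2 * Real.pi), ∫ φ in (0 : ℝ)..(2 * Real.pi), B n m c η i j θ φ = 0 := by
  have hη' : ‖star η‖ < 1 := by simpa using hη
  rcases h with h | h
  · rw [swap _ (B_cont n m c hs η hη i j)]
    have : ∀ φ, ∫ θ in (0 : ℝ)..(2 * Real.pi), B n m c η i j θ φ = 0 := by
      intro φ
      refine vanish (fun z => e φ ^ (m - j) * (evalP n m (fun i j => c i (m - j)) z (star η) /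
        (evalP n m c z (e φ) * (1 - e φ * star η)))) ?_ (n - i) (by omega)
      refine DifferentiableOn.const_mul (DifferentiableOn.div
        (evalP_diff1 n m _ _).differentiableOn
        ((evalP_diff1 n m c (e φ)).differentiableOn.mul_const _) ?_) _
      intro z hz
      exact mul_ne_zero (hs _ _ (by simpa using hz) (e_norm _).le)
        (one_sub_ne (by simp [e_norm]) hη')
    simp [this]
  · have : ∀ θ, ∫ φ in (0 : ℝ)..(2 * Real.pi), B n m c η i j θ φ = 0 := by
      intro θ
      unfold B
      rw [intervalIntegral.integral_const_mul]
      rw [vanish (fun w => (evalP n m (fun i j => c i (m - j)) (e θ) (star η) /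
        (evalP n m c (e θ) w * (1 - w * star η)))) ?_ (m - j) (by omega), mul_zero]
      refine DifferentiableOn.div (differentiableOn_const _)
        ((evalP_diff2 n m c (e θ)).differentiableOn.mul (by fun_prop)) ?_
      intro w hw
      have hw' : ‖w‖ ≤ 1 := by simpa using hw
      exact mul_ne_zero (hs _ _ (e_norm _).le hw') (one_sub_ne hw' hη')
    simp [this]

lemma small (n m : ℕ) (c : ℕ → ℕ → ℂ) (hs : Stable n m c)
    (a : ℕ → ℕ → ℕ → ℂ) (ha : IsLCoeff n m c a) (η : ℂ) (hη : ‖η‖ < 1) (i j : ℤ)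
    (h1 : (n : ℤ) < i ∨ (i ≠ n ∧ 0 ≤ j)) (h2 : i < (n : ℤ) ∨ j < m) :
    ip n m c (tmono i j) (fun θ φ => Lsum n m a (e θ) (e φ) η) = 0 := by
  unfold ip
  simp only [integrand n m c hs a ha η hη]
  have cA := A_cont n m c hs η hη i j
  have cB : Continuous (Function.uncurry fun θ φ => star (B n m c η i j θ φ)) :=
    continuous_star.comp (B_cont n m c hs η hη i j)
  have e1 : ∀ θ, ∫ φ in (0 : ℝ)..(2 * Real.pi), (A n m c η i j θ φ - star (B n m c η i j θ φ)) =
      (∫ φ in (0 : ℝ)..(2 * Real.pi), A n m c η i j θ φ) -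
        ∫ φ in (0 : ℝ)..(2 * Real.pi), star (B n m c η i j θ φ) := fun θ =>
    intervalIntegral.integral_sub
      ((cA.comp (Continuous.prodMk_right θ)).intervalIntegrable _ _)
      ((cB.comp (Continuous.prodMk_right θ)).intervalIntegrable _ _)
  simp only [e1]
  rw [intervalIntegral.integral_sub
    ((intervalIntegral.continuous_parametric_intervalIntegral_of_continuous' cA _ _).intervalIntegrable _ _)
    ((intervalIntegral.continuous_parametric_intervalIntegral_of_continuous' cB _ _).intervalIntegrable _ _),
    A_int n m c hs η hη i j h1]
  simp only [int_star]
  rw [B_int n m c hs η hη i j h2]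
  simp

/-- coefficient integrand -/
noncomputable def G (n m : ℕ) (c : ℕ → ℕ → ℂ) (a : ℕ → ℕ → ℕ → ℂ) (i j : ℤ) (k : ℕ) (θ φ : ℝ) : ℂ :=
  tmono i j θ φ * star (evalP (2 * n) (m - 1) (a k) (e θ) (e φ)) /
      ((Complex.normSq (onT n m c θ φ) : ℝ) : ℂ)

lemma G_cont (n m : ℕ) (c : ℕ → ℕ → ℂ) (hs : Stable n m c) (a : ℕ → ℕ → ℕ → ℂ) (i j : ℤ) (k : ℕ) :
    Continuous (Function.uncurry (G n m c a i j k)) := by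
  have h1 : Continuous fun x : ℝ × ℝ => e x.1 := e_cont.comp continuous_fst
  have h2 : Continuous fun x : ℝ × ℝ => e x.2 := e_cont.comp continuous_snd
  unfold G Function.uncurry
  refine Continuous.div (Continuous.mul (by unfold tmono; fun_prop)
    (continuous_star.comp (evalP_comp _ _ _ h1 h2)))
    (Complex.continuous_ofReal.comp (Complex.continuous_normSq.comp
      (evalP_comp n m c h1 h2))) ?_
  intro x
  have := hs _ _ (e_norm x.1).le (e_norm x.2).le
  simpa [onT, e, Complex.normSq_eq_zero] using this

lemma ip_poly (n m : ℕ) (c : ℕ → ℕ → ℂ) (hs : Stable n m c) (a : ℕ → ℕ → ℕ → ℂ) (i j : ℤ)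
    (η : ℂ) :
    ip n m c (tmono i j) (fun θ φ => Lsum n m a (e θ) (e φ) η) =
      ∑ k ∈ Finset.range m, ((1 / (2 * Real.pi) ^ 2 : ℂ) *
        ∫ θ in (0 : ℝ)..(2 * Real.pi), ∫ φ in (0 : ℝ)..(2 * Real.pi), G n m c a i j k θ φ)
          * η ^ k := by
  unfold ip
  have e0 : ∀ θ φ, tmono i j θ φ * star (Lsum n m a (e θ) (e φ) η) /
      ((Complex.normSq (onT n m c θ φ) : ℝ) : ℂ) =
      ∑ k ∈ Finset.range m, G n m c a i j k θ φ * η ^ k := by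
    intro θ φ
    unfold Lsum G
    rw [star_sum, Finset.mul_sum, Finset.sum_div]
    apply Finset.sum_congr rfl
    intro k _
    rw [star_mul', star_pow, star_star]
    ring
  have cG := fun k => G_cont n m c hs a i j k
  have e1 : ∀ θ, ∫ φ in (0 : ℝ)..(2 * Real.pi), ∑ k ∈ Finset.range m, G n m c a i j k θ φ * η ^ k =
      ∑ k ∈ Finset.range m, (∫ φ in (0 : ℝ)..(2 * Real.pi), G n m c a i j k θ φ) * η ^ k := by
    intro θ
    rw [intervalIntegral.integral_finsetSum]
    · simp only [intervalIntegral.integral_mul_const]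
    · intro k _
      exact (((cG k).comp (Continuous.prodMk_right θ)).mul_const _).intervalIntegrable _ _
  simp only [e0, e1]
  rw [intervalIntegral.integral_finsetSum]
  · simp only [intervalIntegral.integral_mul_const, Finset.mul_sum, mul_assoc]
  · intro k _
    exact ((intervalIntegral.continuous_parametric_intervalIntegral_of_continuous' (cG k) _ _).mul_const
      _).intervalIntegrable _ _

lemma poly_zero (m : ℕ) (b : ℕ → ℂ)
    (h : ∀ η : ℂ, ‖η‖ < 1 → ∑ k ∈ Finset.range m, b k * η ^ k = 0) (η : ℂ) :
    ∑ k ∈ Finset.range m, b k * η ^ k = 0 := by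
  let q : Polynomial ℂ := ∑ k ∈ Finset.range m, Polynomial.C (b k) * Polynomial.X ^ k
  have hq : ∀ x, q.eval x = ∑ k ∈ Finset.range m, b k * x ^ k := by
    intro x; simp [q, Polynomial.eval_finsetSum]
  have : q = 0 := by
    apply Polynomial.eq_zero_of_infinite_isRoot
    have hinf : (Metric.ball (0 : ℂ) 1).Infinite :=
      infinite_of_mem_nhds 0 (Metric.ball_mem_nhds 0 one_pos)
    refine hinf.mono fun x hx => ?_
    have hx' : ‖x‖ < 1 := by simpa using hx
    change q.eval x = 0
    rw [hq, h x hx']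
  rw [← hq, this, Polynomial.eval_zero]

end St9

/-- for every fixed η ∈ ℂ, L(·,·;η) is orthogonal to
O = {z^i w^j : i>n, j<0} ∪ {z^i w^j : i≠n, 0≤j<m} ∪ {z^i w^j : i<n, j≥m}. -/
theorem statement9 (n m : ℕ) (c : ℕ → ℕ → ℂ)
    (hstable : Stable n m c) (hdeg : DegreeNM n m c)
    (a : ℕ → ℕ → ℕ → ℂ) (ha : IsLCoeff n m c a)
    (η : ℂ) (i j : ℤ)
    (hij : ((n : ℤ) < i ∧ j < 0)
      ∨ (i ≠ (n : ℤ) ∧ 0 ≤ j ∧ j < (m : ℤ))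
      ∨ (i < (n : ℤ) ∧ (m : ℤ) ≤ j)) :
    ip n m c (tmono i j)
      (fun θ φ => Lsum n m a (Complex.exp ((θ : ℂ) * Complex.I))
        (Complex.exp ((φ : ℂ) * Complex.I)) η) = 0 := by
  have h1 : (n : ℤ) < i ∨ (i ≠ n ∧ 0 ≤ j) := by omega
  have h2 : i < (n : ℤ) ∨ j < m := by omega
  change ip n m c (tmono i j) (fun θ φ => Lsum n m a (St9.e θ) (St9.e φ) η) = 0
  rw [St9.ip_poly n m c hstable]
  apply St9.poly_zero
  intro ξ hξ
  rw [← St9.ip_poly n m c hstable]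
  exact St9.small n m c hstable a ha ξ hξ i j h1 h2
end

section
/- Let p be stable of degree (n,m) and L its associated kernel. For each fixed z ∈ T (the unit circle), ∫_T |L(z,w;η)|² |dw|/(2π |p(z,w)|²) = z̄^n L(z,η;η), and consequently ∫_T conj(a_i(z,w)) a_j(z,w) |dw|/(2π|p(z,w)|²) = T_{i,j}(z), the (i,j) entry of the Schur–Cohn matrix T_m(z). -/
open Complex MeasureTheory Finset
open scoped ComplexInnerProductSpace

noncomputable section

/-- The coefficient polynomial `p_l(z)` of `w^l` in `p(z,w)`, with `ℤ` index
(zero outside `0 ≤ l ≤ m`). -/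
def pcoefZ (n m : ℕ) (c : ℕ → ℕ → ℂ) (l : ℤ) (z : ℂ) : ℂ :=
  if 0 ≤ l ∧ l ≤ (m : ℤ) then ∑ s ∈ Finset.range (n + 1), c s l.toNat * z ^ s else 0

/-- The `(i,j)` entry of the Schur–Cohn matrix
`T_m(z) = Toep(p)·Toep(p)* − Hank(p̃)·Hank(p̃)*`, for `|z| = 1`. -/
def Tentry (n m : ℕ) (c : ℕ → ℕ → ℂ) (i j : ℕ) (z : ℂ) : ℂ :=
  ∑ k ∈ Finset.range m,
    (pcoefZ n m c ((i : ℤ) - (k : ℤ)) z * star (pcoefZ n m c ((j : ℤ) - (k : ℤ)) z)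
      - star (pcoefZ n m c ((m : ℤ) - (i : ℤ) + (k : ℤ)) z)
          * pcoefZ n m c ((m : ℤ) - (j : ℤ) + (k : ℤ)) z)

end


lemma s18_zero (g p : Polynomial ℂ) (hp : ∀ w : ℂ, ‖w‖ ≤ 1 → p.eval w ≠ 0) :
    ∫ φ in (0 : ℝ)..(2 * Real.pi), Complex.exp ((φ : ℂ) * Complex.I) *
      (g.eval (Complex.exp ((φ : ℂ) * Complex.I)) / p.eval (Complex.exp ((φ : ℂ) * Complex.I))) = 0 := by
  have h : ∮ w in C(0, 1), g.eval w / p.eval w = 0 := by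
    apply Complex.circleIntegral_eq_zero_of_differentiable_on_off_countable zero_le_one
      (s := ∅) Set.countable_empty
    · apply ContinuousOn.div g.continuous.continuousOn p.continuous.continuousOn
      intro w hw
      exact hp w (by simpa using hw)
    · intro w hw
      apply DifferentiableAt.div g.differentiableAt p.differentiableAt
      apply hp w
      have := hw.1
      simp at this
      exact this.le
  rw [circleIntegral] at h
  simp only [deriv_circleMap, circleMap, ofReal_one, one_mul, zero_add, smul_eq_mul] at h
  have h2 : Complex.I * ∫ φ in (0 : ℝ)..(2 * Real.pi), Complex.exp ((φ : ℂ) * Complex.I) *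
      (g.eval (Complex.exp ((φ : ℂ) * Complex.I)) / p.eval (Complex.exp ((φ : ℂ) * Complex.I))) = 0 := by
    rw [← h, ← intervalIntegral.integral_const_mul]
    congr 1; ext φ; ring
  simpa using h2

lemma s18_star_exp (φ : ℝ) : star (Complex.exp ((φ : ℂ) * Complex.I)) = (Complex.exp ((φ : ℂ) * Complex.I))⁻¹ := by
  rw [← Complex.exp_neg, Complex.star_def, ← Complex.exp_conj]
  simp

lemma s18_orth (i l : ℕ) :
    ∫ φ in (0 : ℝ)..(2 * Real.pi), star (Complex.exp ((φ : ℂ) * Complex.I)) ^ i *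
      Complex.exp ((φ : ℂ) * Complex.I) ^ l = if l = i then (2 * Real.pi : ℂ) else 0 := by
  have h : ∀ φ : ℝ, star (Complex.exp ((φ : ℂ) * Complex.I)) ^ i *
      Complex.exp ((φ : ℂ) * Complex.I) ^ l = Complex.exp ((((l : ℂ) - i) * Complex.I) * φ) := by
    intro φ
    rw [s18_star_exp, ← Complex.exp_neg, ← Complex.exp_nat_mul, ← Complex.exp_nat_mul, ← Complex.exp_add]
    congr 1; ring
  simp_rw [h]
  split_ifs with hl
  · subst hl; simp
  · have hne : ((l : ℂ) - i) * Complex.I ≠ 0 := by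
      apply mul_ne_zero _ Complex.I_ne_zero
      rw [sub_ne_zero]; exact_mod_cast hl
    rw [integral_exp_mul_complex hne]
    have := Complex.exp_int_mul_two_pi_mul_I ((l : ℤ) - i)
    push_cast at this ⊢
    rw [show ((l : ℂ) - i) * Complex.I * (2 * Real.pi) = ((l : ℂ) - i) * (2 * Real.pi * Complex.I) by ring, this]
    simp

lemma s18_orth_poly (i : ℕ) (f : Polynomial ℂ) :
    ∫ φ in (0 : ℝ)..(2 * Real.pi), star (Complex.exp ((φ : ℂ) * Complex.I)) ^ i *
      f.eval (Complex.exp ((φ : ℂ) * Complex.I)) = (2 * Real.pi : ℂ) * f.coeff i := by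
  induction f using Polynomial.induction_on' with
  | add p q hp hq =>
    simp only [Polynomial.eval_add, mul_add, Polynomial.coeff_add]
    rw [intervalIntegral.integral_add, hp, hq]
    all_goals
      apply Continuous.intervalIntegrable
      fun_prop
  | monomial l a =>
    have h : ∀ φ : ℝ, star (Complex.exp ((φ : ℂ) * Complex.I)) ^ i *
      (Polynomial.monomial l a).eval (Complex.exp ((φ : ℂ) * Complex.I)) = a * (star (Complex.exp ((φ : ℂ) * Complex.I)) ^ i *
      Complex.exp ((φ : ℂ) * Complex.I) ^ l) := by
      intro φ; rw [Polynomial.eval_monomial]; ring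
    simp_rw [h]
    rw [intervalIntegral.integral_const_mul, s18_orth, Polynomial.coeff_monomial]
    split_ifs <;> ring

lemma s18_pointwise (m : ℕ) (P : ℕ → ℂ) (p q f Ai : Polynomial ℂ)
    (hp : p = ∑ j ∈ Finset.range (m + 1), Polynomial.C (P j) * Polynomial.X ^ j)
    (hq : q = ∑ j ∈ Finset.range (m + 1), Polynomial.C (star (P (m - j))) * Polynomial.X ^ j)
    (fc : ℕ → ℂ) (hf : f = ∑ j ∈ Finset.range m, Polynomial.C (fc j) * Polynomial.X ^ j)
    (i : ℕ) (hi : i < m)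
    (hA : ∀ w : ℂ, Ai.eval w = ∑ k ∈ Finset.range (i + 1), w ^ k *
      (star (P (i - k)) * p.eval w - P (m - (i - k)) * q.eval w))
    (w : ℂ) (hw : w * star w = 1) (hpw : p.eval w ≠ 0) :
    star (Ai.eval w) * f.eval w / ((Complex.normSq (p.eval w) : ℝ) : ℂ)
      = star w ^ i * f.eval w
        - w * (((∑ l ∈ Finset.range (m - i), Polynomial.C (P (i + 1 + l)) * Polynomial.X ^ l) * f).eval w
            / p.eval w)
        - star (w * (((∑ k ∈ Finset.range (i + 1), Polynomial.C (P (m - (i - k))) * Polynomial.X ^ k) *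
            (∑ l ∈ Finset.range m, Polynomial.C (star (fc l)) * Polynomial.X ^ (m - 1 - l))).eval w
            / p.eval w)) := by
  have hpow : ∀ k : ℕ, w ^ k * star w ^ k = 1 := fun k => by rw [← mul_pow, hw, one_pow]
  have hns : ((Complex.normSq (p.eval w) : ℝ) : ℂ) = p.eval w * star (p.eval w) := by
    rw [Complex.star_def, Complex.mul_conj]
  have hpw' : star (p.eval w) ≠ 0 := by simpa using hpw
  set G1 := (∑ l ∈ Finset.range (m - i), Polynomial.C (P (i + 1 + l)) * Polynomial.X ^ l).eval w with hG1
  set G2 := (∑ k ∈ Finset.range (i + 1), Polynomial.C (P (m - (i - k))) * Polynomial.X ^ k).eval w with hG2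
  set F := (∑ l ∈ Finset.range m, Polynomial.C (star (fc l)) * Polynomial.X ^ (m - 1 - l)).eval w with hF
  have f1 : star w ^ i * p.eval w = (∑ k ∈ Finset.range (i + 1), star w ^ k * P (i - k)) + w * G1 := by
    rw [hG1, hp]
    simp only [Polynomial.eval_finsetSum, Polynomial.eval_mul, Polynomial.eval_C, Polynomial.eval_pow,
      Polynomial.eval_X]
    rw [show m + 1 = (i + 1) + (m - i) by omega, Finset.sum_range_add, mul_add]
    congr 1
    · rw [← Finset.sum_range_reflect, Finset.mul_sum]
      apply Finset.sum_congr rfl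
      intro k hk
      have hk' : k ≤ i := by simp at hk; omega
      rw [show i + 1 - 1 - k = i - k by omega]
      obtain ⟨d, rfl⟩ := Nat.exists_eq_add_of_le hk'
      rw [show k + d - k = d by omega, pow_add]
      linear_combination (star w ^ k * P d) * hpow d
    · rw [Finset.mul_sum, Finset.mul_sum]
      apply Finset.sum_congr rfl
      intro k hk
      rw [show i + 1 + k = i + (1 + k) by ring, pow_add, pow_add]
      linear_combination (P (i + (1+k)) * w * w ^ k) * hpow i
  have f2 : star (q.eval w) = star w ^ m * p.eval w := by
    rw [hq, hp]
    simp only [Polynomial.eval_finsetSum, Polynomial.eval_mul, Polynomial.eval_C, Polynomial.eval_pow,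
      Polynomial.eval_X, star_sum, star_mul', star_pow, star_star]
    rw [← Finset.sum_range_reflect, Finset.mul_sum]
    apply Finset.sum_congr rfl
    intro k hk
    have hk' : k ≤ m := by simp at hk; omega
    rw [show m + 1 - 1 - k = m - k by omega]
    obtain ⟨d, rfl⟩ := Nat.exists_eq_add_of_le hk'
    rw [show k + d - k = d by omega, show k + d - d = k by omega, pow_add]
    linear_combination -(star w ^ d * P k) * hpow k
  have f3 : star w * star F = star w ^ m * f.eval w := by
    rw [hF, hf]
    simp only [Polynomial.eval_finsetSum, Polynomial.eval_mul, Polynomial.eval_C, Polynomial.eval_pow,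
      Polynomial.eval_X, star_sum, star_mul', star_pow, star_star]
    rw [Finset.mul_sum, Finset.mul_sum]
    apply Finset.sum_congr rfl
    intro k hk
    have hk' : k + 1 ≤ m := by simp at hk; omega
    obtain ⟨d, rfl⟩ := Nat.exists_eq_add_of_le hk'
    rw [show k + 1 + d - 1 - k = d by omega, pow_add, pow_add]
    linear_combination -(star w ^ d * star w * fc k) * hpow k
  have f4 : star (Ai.eval w) = (∑ k ∈ Finset.range (i + 1), star w ^ k * P (i - k)) * star (p.eval w)
      - star G2 * star (q.eval w) := by
    rw [hA, hG2]
    simp only [Polynomial.eval_finsetSum, Polynomial.eval_mul, Polynomial.eval_C, Polynomial.eval_pow,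
      Polynomial.eval_X, star_sum, star_mul', star_pow, star_star, star_sub]
    rw [Finset.sum_mul, Finset.sum_mul, ← Finset.sum_sub_distrib]
    apply Finset.sum_congr rfl
    intro k hk
    ring
  rw [hns, f4, f2, Polynomial.eval_mul, Polynomial.eval_mul, ← hG1, ← hG2, ← hF, star_mul', star_div₀,
    star_mul']
  have f5 : (∑ k ∈ Finset.range (i + 1), star w ^ k * P (i - k)) = star w ^ i * p.eval w - w * G1 := by
    rw [f1]; ring
  rw [f5]
  field_simp
  linear_combination (star G2 * p.eval w) * f3

lemma s18_integral (m : ℕ) (P : ℕ → ℂ) (p q f Ai : Polynomial ℂ)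
    (hp : p = ∑ j ∈ Finset.range (m + 1), Polynomial.C (P j) * Polynomial.X ^ j)
    (hpne : ∀ w : ℂ, ‖w‖ ≤ 1 → p.eval w ≠ 0)
    (hq : q = ∑ j ∈ Finset.range (m + 1), Polynomial.C (star (P (m - j))) * Polynomial.X ^ j)
    (fc : ℕ → ℂ) (hf : f = ∑ j ∈ Finset.range m, Polynomial.C (fc j) * Polynomial.X ^ j)
    (i : ℕ) (hi : i < m)
    (hA : ∀ w : ℂ, Ai.eval w = ∑ k ∈ Finset.range (i + 1), w ^ k *
      (star (P (i - k)) * p.eval w - P (m - (i - k)) * q.eval w)) :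
    ∫ φ in (0 : ℝ)..(2 * Real.pi), star (Ai.eval (Complex.exp ((φ : ℂ) * Complex.I))) *
      f.eval (Complex.exp ((φ : ℂ) * Complex.I)) /
        ((Complex.normSq (p.eval (Complex.exp ((φ : ℂ) * Complex.I))) : ℝ) : ℂ)
      = (2 * Real.pi : ℂ) * f.coeff i := by
  have hn : ∀ φ : ℝ, p.eval (Complex.exp ((φ : ℂ) * Complex.I)) ≠ 0 := fun φ =>
    hpne _ (Complex.norm_exp_ofReal_mul_I φ).le
  have hc : ∀ g : Polynomial ℂ, Continuous (fun φ : ℝ => g.eval (Complex.exp ((φ : ℂ) * Complex.I))) :=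
    fun g => g.continuous.comp (by fun_prop)
  have hcd : ∀ g : Polynomial ℂ, Continuous (fun φ : ℝ => Complex.exp ((φ : ℂ) * Complex.I) *
      (g.eval (Complex.exp ((φ : ℂ) * Complex.I)) / p.eval (Complex.exp ((φ : ℂ) * Complex.I)))) :=
    fun g => Continuous.mul (by fun_prop) ((hc g).div (hc p) hn)
  have hpt := fun φ : ℝ => s18_pointwise m P p q f Ai hp hq fc hf i hi hA
    (Complex.exp ((φ : ℂ) * Complex.I))
    (by rw [s18_star_exp, mul_inv_cancel₀ (Complex.exp_ne_zero _)]) (hn φ)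
  simp_rw [hpt]
  rw [intervalIntegral.integral_sub, intervalIntegral.integral_sub, s18_orth_poly, s18_zero _ _ hpne]
  · simp only [Complex.star_def]
    rw [intervalIntegral.intervalIntegral_conj, s18_zero _ _ hpne]
    simp
  · exact (Continuous.mul (by fun_prop) (hc f)).intervalIntegrable _ _
  · exact (hcd _).intervalIntegrable _ _
  · exact ((Continuous.mul (by fun_prop) (hc f)).sub (hcd _)).intervalIntegrable _ _
  · exact (continuous_star.comp (hcd _)).intervalIntegrable _ _

/-- Algebraic part: solve the recurrence coming from the kernel identity. -/
lemma s18_solve (m : ℕ) (P : ℕ → ℂ) (A : ℕ → ℂ) (w p q : ℂ)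
    (h : ∀ u : ℂ, (1 - w * u) * ∑ k ∈ Finset.range m, A k * u ^ k =
      p * ∑ j ∈ Finset.range (m + 1), star (P j) * u ^ j
        - q * ∑ j ∈ Finset.range (m + 1), P (m - j) * u ^ j) :
    ∀ i < m, A i = ∑ k ∈ Finset.range (i + 1), w ^ k * (star (P (i - k)) * p - P (m - (i - k)) * q) := by
  have hpoly : (1 - Polynomial.C w * Polynomial.X) *
      ∑ k ∈ Finset.range m, Polynomial.C (A k) * Polynomial.X ^ k =
      Polynomial.C p * ∑ j ∈ Finset.range (m + 1), Polynomial.C (star (P j)) * Polynomial.X ^ j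
        - Polynomial.C q * ∑ j ∈ Finset.range (m + 1), Polynomial.C (P (m - j)) * Polynomial.X ^ j := by
    apply Polynomial.funext
    intro u
    simpa [Polynomial.eval_finsetSum] using h u
  have hco : ∀ (N : ℕ) (B : ℕ → ℂ) (i : ℕ), i < N →
      (∑ k ∈ Finset.range N, Polynomial.C (B k) * Polynomial.X ^ k).coeff i = B i := by
    intro N B i hi
    simp [Polynomial.coeff_X_pow, hi]
  intro i
  induction i with
  | zero =>
    intro hi
    have := congrArg (fun r => Polynomial.coeff r 0) hpoly
    simp only [sub_mul, one_mul, Polynomial.coeff_sub, Polynomial.coeff_C_mul, mul_assoc,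
      Polynomial.coeff_X_mul_zero] at this
    rw [hco _ _ _ hi, hco _ _ _ (by omega), hco (m + 1) (fun j => P (m - j)) _ (by omega)] at this
    simp only [zero_add, Finset.sum_range_one, pow_zero, one_mul]
    linear_combination this
  | succ i ih =>
    intro hi
    have := congrArg (fun r => Polynomial.coeff r (i + 1)) hpoly
    simp only [sub_mul, one_mul, Polynomial.coeff_sub, Polynomial.coeff_C_mul, mul_assoc,
      Polynomial.coeff_X_mul] at this
    rw [hco _ _ _ hi, hco _ _ _ (by omega), hco _ _ _ (by omega),
      hco (m + 1) (fun j => P (m - j)) _ (by omega), ih (by omega)] at this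
    rw [Finset.sum_range_succ']
    simp only [Nat.add_sub_add_right, pow_zero, one_mul, Nat.sub_zero]
    have e : ∀ k, w ^ (k + 1) * (star (P (i - k)) * p - P (m - (i - k)) * q) =
        w * (w ^ k * (star (P (i - k)) * p - P (m - (i - k)) * q)) := fun k => by ring
    simp_rw [e]
    rw [← Finset.mul_sum]
    linear_combination this

lemma s18_evalP (n m : ℕ) (c : ℕ → ℕ → ℂ) (z w : ℂ) :
    evalP n m c z w = ∑ j ∈ Finset.range (m + 1),
      (∑ s ∈ Finset.range (n + 1), c s j * z ^ s) * w ^ j := by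
  unfold evalP
  rw [Finset.sum_comm]
  simp_rw [Finset.sum_mul]

lemma s18_refl (n m : ℕ) (c : ℕ → ℕ → ℂ) (z w : ℂ) (hz : z * star z = 1) :
    evalP n m (reflC n m c) z w = z ^ n * ∑ j ∈ Finset.range (m + 1),
      star (∑ s ∈ Finset.range (n + 1), c s (m - j) * z ^ s) * w ^ j := by
  rw [s18_evalP, Finset.mul_sum]
  apply Finset.sum_congr rfl
  intro j _
  rw [← mul_assoc]
  congr 1
  rw [star_sum, ← Finset.sum_range_reflect, Finset.mul_sum]
  apply Finset.sum_congr rfl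
  intro s hs
  have hk' : s ≤ n := by simp at hs; omega
  unfold reflC
  rw [show n + 1 - 1 - s = n - s by omega]
  obtain ⟨d, rfl⟩ := Nat.exists_eq_add_of_le hk'
  rw [show s + d - s = d by omega, show s + d - d = s by omega, star_mul', star_pow, pow_add]
  have hpow : z ^ s * star z ^ s = 1 := by rw [← mul_pow, hz, one_pow]
  linear_combination -(z ^ d * star (c s (m - j))) * hpow

lemma s18_coeff (N : ℕ) (B : ℕ → ℂ) (i : ℕ) (hi : i < N) :
    (∑ k ∈ Finset.range N, Polynomial.C (B k) * Polynomial.X ^ k).coeff i = B i := by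
  simp [Polynomial.coeff_X_pow, hi]

lemma s18_T (n m : ℕ) (c : ℕ → ℕ → ℂ) (z : ℂ) (P : ℕ → ℂ)
    (hP : P = fun j => ∑ s ∈ Finset.range (n + 1), c s j * z ^ s) (p q Aj : Polynomial ℂ)
    (hp : p = ∑ j ∈ Finset.range (m + 1), Polynomial.C (P j) * Polynomial.X ^ j)
    (hq : q = ∑ j ∈ Finset.range (m + 1), Polynomial.C (star (P (m - j))) * Polynomial.X ^ j)
    (i j : ℕ) (hi : i < m) (hj : j < m)
    (hA : ∀ w : ℂ, Aj.eval w = ∑ k ∈ Finset.range (j + 1), w ^ k *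
      (star (P (j - k)) * p.eval w - P (m - (j - k)) * q.eval w)) :
    Aj.coeff i = Tentry n m c i j z := by
  have hpoly : Aj = ∑ k ∈ Finset.range (j + 1), Polynomial.X ^ k *
      (Polynomial.C (star (P (j - k))) * p - Polynomial.C (P (m - (j - k))) * q) := by
    apply Polynomial.funext
    intro w
    rw [hA]
    simp [Polynomial.eval_finsetSum]
  have hz0 : ∀ l : ℤ, l < 0 → pcoefZ n m c l z = 0 := by
    intro l hl
    unfold pcoefZ
    rw [if_neg (by omega)]
  have hz1 : ∀ l : ℤ, (m : ℤ) < l → pcoefZ n m c l z = 0 := by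
    intro l hl
    unfold pcoefZ
    rw [if_neg (by omega)]
  have hz2 : ∀ (l : ℤ) (d : ℕ), l = d → d ≤ m → pcoefZ n m c l z = P d := by
    intro l d hl hd
    unfold pcoefZ
    rw [if_pos (by omega), hP, hl]
    simp
  rw [hpoly, Polynomial.finsetSum_coeff]
  unfold Tentry
  rw [← Finset.sum_subset (Finset.range_subset_range.2 (show j + 1 ≤ m by omega))]
  · apply Finset.sum_congr rfl
    intro k hk
    have hk' : k ≤ j := by simp at hk; omega
    rw [Polynomial.coeff_X_pow_mul']
    split_ifs with hki
    · rw [Polynomial.coeff_sub, Polynomial.coeff_C_mul, Polynomial.coeff_C_mul, hp, hq,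
        s18_coeff _ _ _ (by omega), s18_coeff (m + 1) (fun j => star (P (m - j))) _ (by omega),
        hz2 ((i : ℤ) - k) (i - k) (by omega) (by omega), hz2 ((j : ℤ) - k) (j - k) (by omega) (by omega),
        hz2 ((m : ℤ) - i + k) (m - (i - k)) (by omega) (by omega),
        hz2 ((m : ℤ) - j + k) (m - (j - k)) (by omega) (by omega)]
      ring
    · rw [hz0 ((i : ℤ) - k) (by omega), hz1 ((m : ℤ) - i + k) (by omega)]
      simp
  · intro k _ hk
    have hk' : j < k := by simp at hk; omega
    rw [hz0 ((j : ℤ) - k) (by omega), hz1 ((m : ℤ) - j + k) (by omega)]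
    simp

/-- for fixed z on the unit circle,
∫_𝕋 |L(z,w;η)|² |dw|/(2π|p(z,w)|²) = z̄ⁿ L(z,η;η), and consequently
∫_𝕋 conj(a_i(z,w)) a_j(z,w) |dw|/(2π|p(z,w)|²) = T_{i,j}(z). -/
theorem statement18 (n m : ℕ) (c : ℕ → ℕ → ℂ)
    (hstable : Stable n m c) (hdeg : DegreeNM n m c)
    (a : ℕ → ℕ → ℕ → ℂ) (ha : IsLCoeff n m c a)
    (z : ℂ) (hz : ‖z‖ = 1) :
    (∀ η : ℂ,
      (1 / (2 * Real.pi) : ℂ) *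
        ∫ φ in (0 : ℝ)..(2 * Real.pi),
          ((Complex.normSq (Lsum n m a z (Complex.exp ((φ : ℂ) * Complex.I)) η) : ℝ) : ℂ) /
            ((Complex.normSq (evalP n m c z (Complex.exp ((φ : ℂ) * Complex.I))) : ℝ) : ℂ)
      = (star z) ^ n * Lsum n m a z η η)
    ∧ ∀ i j : ℕ, i < m → j < m →
      (1 / (2 * Real.pi) : ℂ) *
        ∫ φ in (0 : ℝ)..(2 * Real.pi),
          star (evalP (2 * n) (m - 1) (a i) z (Complex.exp ((φ : ℂ) * Complex.I))) *
            evalP (2 * n) (m - 1) (a j) z (Complex.exp ((φ : ℂ) * Complex.I)) /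
              ((Complex.normSq (evalP n m c z (Complex.exp ((φ : ℂ) * Complex.I))) : ℝ) : ℂ)
      = Tentry n m c i j z := by
  have hzz : z * star z = 1 := by
    rw [Complex.star_def, Complex.mul_conj, Complex.normSq_eq_norm_sq, hz]; simp
  have hz0 : z ≠ 0 := by rintro rfl; simp at hz
  have hzinv : (star z)⁻¹ = z := inv_eq_of_mul_eq_one_left hzz
  have hzn : z ^ n * star z ^ n = 1 := by rw [← mul_pow, hzz, one_pow]
  obtain ⟨P, hP⟩ : ∃ P : ℕ → ℂ, P = fun j => ∑ s ∈ Finset.range (n + 1), c s j * z ^ s := ⟨_, rfl⟩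
  obtain ⟨p, hp⟩ : ∃ p : Polynomial ℂ,
    p = ∑ j ∈ Finset.range (m + 1), Polynomial.C (P j) * Polynomial.X ^ j := ⟨_, rfl⟩
  obtain ⟨q, hq⟩ : ∃ q : Polynomial ℂ,
    q = ∑ j ∈ Finset.range (m + 1), Polynomial.C (star (P (m - j))) * Polynomial.X ^ j := ⟨_, rfl⟩
  obtain ⟨b, hb⟩ : ∃ b : ℕ → ℕ → ℂ,
    b = fun k i => star z ^ n * ∑ s ∈ Finset.range (2 * n + 1), a k s i * z ^ s := ⟨_, rfl⟩
  obtain ⟨A, hAdef⟩ : ∃ A : ℕ → Polynomial ℂ,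
    A = fun k => ∑ i ∈ Finset.range m, Polynomial.C (b k i) * Polynomial.X ^ i := ⟨_, rfl⟩
  have hpe : ∀ w, evalP n m c z w = p.eval w := by
    intro w
    rw [s18_evalP, hp, hP]
    simp [Polynomial.eval_finsetSum]
  have hpe' : ∀ η, star (p.eval η) = ∑ j ∈ Finset.range (m + 1), star (P j) * star η ^ j := by
    intro η
    rw [hp]
    simp [Polynomial.eval_finsetSum]
  have hqe : ∀ w, evalP n m (reflC n m c) z w = z ^ n * q.eval w := by
    intro w
    rw [s18_refl _ _ _ _ _ hzz, hq, hP]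
    simp [Polynomial.eval_finsetSum]
  have hqe' : ∀ η, star (q.eval η) = ∑ j ∈ Finset.range (m + 1), P (m - j) * star η ^ j := by
    intro η
    rw [hq]
    simp [Polynomial.eval_finsetSum]
  have hpne : ∀ w : ℂ, ‖w‖ ≤ 1 → p.eval w ≠ 0 := by
    intro w hw
    rw [← hpe]
    exact hstable z w hz.le hw
  have hAe : ∀ k < m, ∀ w, evalP (2 * n) (m - 1) (a k) z w = z ^ n * (A k).eval w := by
    intro k hk w
    rw [s18_evalP, show m - 1 + 1 = m by omega, hAdef, hb]
    simp only [Polynomial.eval_finsetSum, Polynomial.eval_mul, Polynomial.eval_C, Polynomial.eval_pow,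
      Polynomial.eval_X]
    rw [Finset.mul_sum]
    apply Finset.sum_congr rfl
    intro i _
    linear_combination -((∑ s ∈ Finset.range (2 * n + 1), a k s i * z ^ s) * w ^ i) * hzn
  have hLs : ∀ w η, Lsum n m a z w η = z ^ n * ∑ k ∈ Finset.range m, (A k).eval w * star η ^ k := by
    intro w η
    unfold Lsum
    rw [Finset.mul_sum]
    apply Finset.sum_congr rfl
    intro k hk
    rw [hAe k (by simpa using hk)]
    ring
  have hker : ∀ w u : ℂ, (1 - w * u) * ∑ k ∈ Finset.range m, (A k).eval w * u ^ k =
      p.eval w * ∑ j ∈ Finset.range (m + 1), star (P j) * u ^ j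
        - q.eval w * ∑ j ∈ Finset.range (m + 1), P (m - j) * u ^ j := by
    intro w u
    have h := ha z w (star u) hz0
    unfold Lnum at h
    rw [hzinv, hLs, hpe, hpe, hqe, hqe, star_mul', hpe', hqe', star_star, star_pow] at h
    apply mul_left_cancel₀ (pow_ne_zero n hz0)
    linear_combination h - (z ^ n * q.eval w * ∑ j ∈ Finset.range (m + 1), P (m - j) * u ^ j) * hzn
  have hA : ∀ i < m, ∀ w, (A i).eval w = ∑ k ∈ Finset.range (i + 1), w ^ k *
      (star (P (i - k)) * p.eval w - P (m - (i - k)) * q.eval w) := fun i hi w =>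
    s18_solve m P (fun k => (A k).eval w) w (p.eval w) (q.eval w) (hker w) i hi
  have hInteg : ∀ i < m, ∀ j, _ := fun i hi j =>
    s18_integral m P p q (A j) (A i) hp hpne hq (b j) (by rw [hAdef]) i hi (hA i hi)
  have hpi : (2 * Real.pi : ℂ) ≠ 0 := by
    exact_mod_cast Real.two_pi_pos.ne'
  have hcoef : ∀ i < m, ∀ j, (A j).coeff i = b j i := by
    intro i hi j
    rw [hAdef]
    exact s18_coeff m (b j) i hi
  have hn : ∀ φ : ℝ, p.eval (Complex.exp ((φ : ℂ) * Complex.I)) ≠ 0 := fun φ =>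
    hpne _ (Complex.norm_exp_ofReal_mul_I φ).le
  have hc : ∀ g : Polynomial ℂ, Continuous (fun φ : ℝ => g.eval (Complex.exp ((φ : ℂ) * Complex.I))) :=
    fun g => g.continuous.comp (by fun_prop)
  constructor
  · intro η
    have e : ∀ φ : ℝ, ((Complex.normSq (Lsum n m a z (Complex.exp ((φ : ℂ) * Complex.I)) η) : ℝ) : ℂ) /
            ((Complex.normSq (evalP n m c z (Complex.exp ((φ : ℂ) * Complex.I))) : ℝ) : ℂ)
        = ∑ i ∈ Finset.range m, ∑ j ∈ Finset.range m, (η ^ i * star η ^ j) *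
          (star ((A i).eval (Complex.exp ((φ : ℂ) * Complex.I))) *
            (A j).eval (Complex.exp ((φ : ℂ) * Complex.I)) /
            ((Complex.normSq (p.eval (Complex.exp ((φ : ℂ) * Complex.I))) : ℝ) : ℂ)) := by
      intro φ
      generalize Complex.exp ((φ : ℂ) * Complex.I) = w
      rw [hpe, ← Complex.mul_conj, ← Complex.star_def, hLs, star_mul', star_pow, star_sum]
      have : z ^ n * (∑ k ∈ Finset.range m, (A k).eval w * star η ^ k) *
          (star z ^ n * ∑ k ∈ Finset.range m, star ((A k).eval w * star η ^ k)) =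
          (∑ k ∈ Finset.range m, star ((A k).eval w * star η ^ k)) *
          (∑ k ∈ Finset.range m, (A k).eval w * star η ^ k) := by
        linear_combination ((∑ k ∈ Finset.range m, star ((A k).eval w * star η ^ k)) *
          (∑ k ∈ Finset.range m, (A k).eval w * star η ^ k)) * hzn
      rw [this, Finset.sum_mul_sum, Finset.sum_div]
      apply Finset.sum_congr rfl
      intro i _
      rw [Finset.sum_div]
      apply Finset.sum_congr rfl
      intro j _
      rw [star_mul', star_pow, star_star]
      ring
    have hI : ∀ i j : ℕ, IntervalIntegrable (fun φ : ℝ => (η ^ i * star η ^ j) *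
          (star ((A i).eval (Complex.exp ((φ : ℂ) * Complex.I))) *
            (A j).eval (Complex.exp ((φ : ℂ) * Complex.I)) /
            ((Complex.normSq (p.eval (Complex.exp ((φ : ℂ) * Complex.I))) : ℝ) : ℂ)))
          volume 0 (2 * Real.pi) := by
      intro i j
      apply Continuous.intervalIntegrable
      refine continuous_const.mul (Continuous.div ((continuous_star.comp (hc _)).mul (hc _))
        (Complex.continuous_ofReal.comp (Complex.continuous_normSq.comp (hc p))) ?_)
      intro φ
      simpa using hn φ
    simp_rw [e]
    rw [intervalIntegral.integral_finsetSum (fun i _ => by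
      have := IntervalIntegrable.sum (Finset.range m) (fun j _ => hI i j)
      simpa only [Finset.sum_fn] using this)]
    have e2 : ∀ i ∈ Finset.range m, (∫ φ in (0 : ℝ)..(2 * Real.pi), ∑ j ∈ Finset.range m,
        (η ^ i * star η ^ j) *
          (star ((A i).eval (Complex.exp ((φ : ℂ) * Complex.I))) *
            (A j).eval (Complex.exp ((φ : ℂ) * Complex.I)) /
            ((Complex.normSq (p.eval (Complex.exp ((φ : ℂ) * Complex.I))) : ℝ) : ℂ)))
        = ∑ j ∈ Finset.range m, (η ^ i * star η ^ j) * ((2 * Real.pi : ℂ) * b j i) := by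
      intro i hi
      have hi' : i < m := by simpa using hi
      rw [intervalIntegral.integral_finsetSum (fun j _ => hI i j)]
      apply Finset.sum_congr rfl
      intro j _
      rw [intervalIntegral.integral_const_mul, hInteg i hi' j, hcoef i hi']
    rw [Finset.sum_congr rfl e2, hLs, Finset.sum_comm, ← mul_assoc, mul_comm (star z ^ n), hzn, one_mul,
      Finset.mul_sum]
    apply Finset.sum_congr rfl
    intro j _
    rw [hAdef]
    simp only [Polynomial.eval_finsetSum, Polynomial.eval_mul, Polynomial.eval_C, Polynomial.eval_pow,
      Polynomial.eval_X]
    rw [Finset.mul_sum, Finset.sum_mul]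
    apply Finset.sum_congr rfl
    intro i _
    field_simp
  · intro i j hi hj
    have e : ∀ φ : ℝ, star (evalP (2 * n) (m - 1) (a i) z (Complex.exp ((φ : ℂ) * Complex.I))) *
            evalP (2 * n) (m - 1) (a j) z (Complex.exp ((φ : ℂ) * Complex.I)) /
              ((Complex.normSq (evalP n m c z (Complex.exp ((φ : ℂ) * Complex.I))) : ℝ) : ℂ)
        = star ((A i).eval (Complex.exp ((φ : ℂ) * Complex.I))) *
            (A j).eval (Complex.exp ((φ : ℂ) * Complex.I)) /
            ((Complex.normSq (p.eval (Complex.exp ((φ : ℂ) * Complex.I))) : ℝ) : ℂ) := by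
      intro φ
      rw [hAe i hi, hAe j hj, hpe, star_mul', star_pow]
      congr 1
      generalize Complex.exp ((φ : ℂ) * Complex.I) = w
      linear_combination (star ((A i).eval w) * (A j).eval w) * hzn
    simp_rw [e]
    rw [hInteg i hi j, ← s18_T n m c z P hP p q (A j) hp hq i j hi hj (hA j hj)]
    field_simp
end
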